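/- arXiv:1507.06684 — 2 statements merged into one kernel-verified Lean document; each statement's English description precedes it below -/
import Mathlib

section
/- Let X be a Hausdorff space, λ an infinite cardinal, and set κ = skL(X, 2^{ψ(X)·λ}) · ψ(X) · λ. Then for every x ∈ X there exists a family 𝒱 of open sets with |𝒱| ≤ κ, x ∈ ⋂𝒱, and |⋂_{V∈𝒱} cl V| ≤ 2^κ. -/
open Cardinal Set

universe u

/-- Skew-λ Lindelöf degree of `A` in `X`. -/
noncomputable def skLrel (X : Type u) [TopologicalSpace X] (A : Set X) (lam : Cardinal.{u}) :
    Cardinal.{u} :=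
  sInf {κ : Cardinal.{u} | ℵ₀ ≤ κ ∧
    ∀ 𝒰 : Set (Set X), (∀ U ∈ 𝒰, IsOpen U) → A ⊆ ⋃₀ 𝒰 →
      ∃ 𝒱 ⊆ 𝒰, #↥𝒱 ≤ κ ∧ #↥(A \ ⋃₀ 𝒱) < lam}

/-- Skew-λ Lindelöf degree of `X`. -/
noncomputable def skL (X : Type u) [TopologicalSpace X] (lam : Cardinal.{u}) : Cardinal.{u} :=
  skLrel X Set.univ lam

/-- Lindelöf degree of `X`. -/
noncomputable def Ldeg (X : Type u) [TopologicalSpace X] : Cardinal.{u} :=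
  sInf {κ : Cardinal.{u} | ℵ₀ ≤ κ ∧
    ∀ 𝒰 : Set (Set X), (∀ U ∈ 𝒰, IsOpen U) → ⋃₀ 𝒰 = Set.univ →
      ∃ 𝒱 ⊆ 𝒰, #↥𝒱 ≤ κ ∧ ⋃₀ 𝒱 = Set.univ}

/-- Pseudocharacter of `X`. -/
noncomputable def psi (X : Type u) [TopologicalSpace X] : Cardinal.{u} :=
  sInf {κ : Cardinal.{u} | ℵ₀ ≤ κ ∧
    ∀ x : X, ∃ 𝒱 : Set (Set X), (∀ V ∈ 𝒱, IsOpen V) ∧ #↥𝒱 ≤ κ ∧ ⋂₀ 𝒱 = {x}}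

/-- Closed pseudocharacter of `X`. -/
noncomputable def psic (X : Type u) [TopologicalSpace X] : Cardinal.{u} :=
  sInf {κ : Cardinal.{u} | ℵ₀ ≤ κ ∧
    ∀ x : X, ∃ 𝒱 : Set (Set X), (∀ V ∈ 𝒱, IsOpen V ∧ x ∈ V) ∧ #↥𝒱 ≤ κ ∧
      (⋂ V ∈ 𝒱, closure V) = {x}}

/-- Tightness of `X`. -/
noncomputable def tight (X : Type u) [TopologicalSpace X] : Cardinal.{u} :=
  sInf {κ : Cardinal.{u} | ℵ₀ ≤ κ ∧
    ∀ (A : Set X) (x : X), x ∈ closure A → ∃ B ⊆ A, #↥B ≤ κ ∧ x ∈ closure B}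

/-- Character of `X`. -/
noncomputable def charDeg (X : Type u) [TopologicalSpace X] : Cardinal.{u} :=
  sInf {κ : Cardinal.{u} | ℵ₀ ≤ κ ∧
    ∀ x : X, ∃ ℬ : Set (Set X), (∀ B ∈ ℬ, IsOpen B ∧ x ∈ B) ∧ #↥ℬ ≤ κ ∧
      ∀ U : Set X, IsOpen U → x ∈ U → ∃ B ∈ ℬ, B ⊆ U}

/-- Density of `X`. -/
noncomputable def dens (X : Type u) [TopologicalSpace X] : Cardinal.{u} :=
  sInf {κ : Cardinal.{u} | ℵ₀ ≤ κ ∧ ∃ D : Set X, Dense D ∧ #↥D ≤ κ}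

/-- θ-network weight of `X`. -/
noncomputable def nwTheta (X : Type u) [TopologicalSpace X] : Cardinal.{u} :=
  sInf {κ : Cardinal.{u} | ℵ₀ ≤ κ ∧
    ∃ 𝒩 : Set (Set X), 𝒩.Nonempty ∧ #↥𝒩 ≤ κ ∧
      ∀ (x : X) (U : Set X), IsOpen U → x ∈ U → ∃ N ∈ 𝒩, x ∈ N ∧ N ⊆ closure U}

/-- Skew-λ almost Lindelöf degree of `A` in `X`. -/
noncomputable def saLrel (X : Type u) [TopologicalSpace X] (A : Set X) (lam : Cardinal.{u}) :
    Cardinal.{u} :=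
  sInf {κ : Cardinal.{u} | ℵ₀ ≤ κ ∧
    ∀ 𝒰 : Set (Set X), (∀ U ∈ 𝒰, IsOpen U) → A ⊆ ⋃₀ 𝒰 →
      ∃ 𝒱 ⊆ 𝒰, #↥𝒱 ≤ κ ∧ #↥(A \ ⋃ V ∈ 𝒱, closure V) < lam}

/-- Skew-λ almost Lindelöf degree of `X`. -/
noncomputable def saL (X : Type u) [TopologicalSpace X] (lam : Cardinal.{u}) : Cardinal.{u} :=
  saLrel X Set.univ lam

/-- Skew-λ almost Lindelöf degree of `X` with respect to closed sets. -/
noncomputable def saLc (X : Type u) [TopologicalSpace X] (lam : Cardinal.{u}) : Cardinal.{u} :=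
  sSup {c : Cardinal.{u} | ∃ A : Set X, IsClosed A ∧ c = saLrel X A lam}

/-- κ-closure of a set. -/
def clk {X : Type u} [TopologicalSpace X] (κ : Cardinal.{u}) (A : Set X) : Set X :=
  ⋃ B ∈ {B : Set X | B ⊆ A ∧ #↥B ≤ κ}, closure B

/-- Skew-λ almost Lindelöf degree of `X` with respect to κ-closed sets. -/
noncomputable def saLk (X : Type u) [TopologicalSpace X] (κ lam : Cardinal.{u}) : Cardinal.{u} :=
  sSup {c : Cardinal.{u} | ∃ A : Set X, clk κ A = A ∧ c = saLrel X A lam}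

/-- Skew-λ weak Lindelöf degree of `A` in `X`. -/
noncomputable def swLrel (X : Type u) [TopologicalSpace X] (A : Set X) (lam : Cardinal.{u}) :
    Cardinal.{u} :=
  sInf {κ : Cardinal.{u} | ℵ₀ ≤ κ ∧
    ∀ 𝒰 : Set (Set X), (∀ U ∈ 𝒰, IsOpen U) → A ⊆ ⋃₀ 𝒰 →
      ∃ 𝒱 ⊆ 𝒰, #↥𝒱 ≤ κ ∧ #↥(A \ closure (⋃₀ 𝒱)) < lam}

/-- Skew-λ weak Lindelöf degree of `X`. -/
noncomputable def swL (X : Type u) [TopologicalSpace X] (lam : Cardinal.{u}) : Cardinal.{u} :=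
  swLrel X Set.univ lam

/-- Skew-λ weak Lindelöf degree of `X` with respect to closed sets. -/
noncomputable def swLc (X : Type u) [TopologicalSpace X] (lam : Cardinal.{u}) : Cardinal.{u} :=
  sSup {c : Cardinal.{u} | ∃ A : Set X, IsClosed A ∧ c = swLrel X A lam}

lemma skL_spec_aux (X : Type u) [TopologicalSpace X] (lam : Cardinal.{u}) (hl : 0 < lam) :
    ℵ₀ ≤ skL X lam ∧
    ∀ 𝒰 : Set (Set X), (∀ U ∈ 𝒰, IsOpen U) → Set.univ ⊆ ⋃₀ 𝒰 →
      ∃ 𝒱 ⊆ 𝒰, #↥𝒱 ≤ skL X lam ∧ #↥(Set.univ \ ⋃₀ 𝒱) < lam := by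
  unfold skL skLrel
  refine csInf_mem (s := {κ : Cardinal.{u} | ℵ₀ ≤ κ ∧
    ∀ 𝒰 : Set (Set X), (∀ U ∈ 𝒰, IsOpen U) → Set.univ ⊆ ⋃₀ 𝒰 →
      ∃ 𝒱 ⊆ 𝒰, #↥𝒱 ≤ κ ∧ #↥(Set.univ \ ⋃₀ 𝒱) < lam}) ?_
  refine ⟨max ℵ₀ #(Set X), le_max_left _ _, fun 𝒰 _ hc => ⟨𝒰, subset_rfl, ?_, ?_⟩⟩
  · exact (mk_set_le 𝒰).trans (le_max_right _ _)
  · rw [Set.diff_eq_empty.2 hc]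
    simpa using hl

lemma psi_spec_aux (X : Type u) [TopologicalSpace X] [T2Space X] :
    ℵ₀ ≤ psi X ∧
    ∀ x : X, ∃ 𝒱 : Set (Set X), (∀ V ∈ 𝒱, IsOpen V) ∧ #↥𝒱 ≤ psi X ∧ ⋂₀ 𝒱 = {x} := by
  unfold psi
  refine csInf_mem (s := {κ : Cardinal.{u} | ℵ₀ ≤ κ ∧
    ∀ x : X, ∃ 𝒱 : Set (Set X), (∀ V ∈ 𝒱, IsOpen V) ∧ #↥𝒱 ≤ κ ∧ ⋂₀ 𝒱 = {x}}) ?_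
  refine ⟨max ℵ₀ #(Set X), le_max_left _ _, fun x => ⟨{V | IsOpen V ∧ x ∈ V}, fun V h => h.1,
    (mk_set_le _).trans (le_max_right _ _), ?_⟩⟩
  ext y
  simp only [Set.mem_sInter, Set.mem_setOf_eq, Set.mem_singleton_iff]
  constructor
  · intro h
    by_contra hne
    exact h {y}ᶜ ⟨isOpen_compl_singleton, fun e => hne (Set.mem_singleton_iff.1 e).symm⟩ rfl
  · rintro rfl V hV
    exact hV.2

/-- Lemma 3.4: for κ = skL(X,2^{ψ(X)·λ})·ψ(X)·λ, each point has a ≤κ-sized family of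
open sets containing it whose closures intersect in a set of size ≤ 2^κ. -/
theorem lemmaA {X : Type u} [TopologicalSpace X] [T2Space X]
    (lam : Cardinal.{u}) (hlam : ℵ₀ ≤ lam) :
    ∀ x : X, ∃ 𝒱 : Set (Set X), (∀ V ∈ 𝒱, IsOpen V) ∧
      #↥𝒱 ≤ skL X (2 ^ (psi X * lam)) * psi X * lam ∧
      x ∈ ⋂₀ 𝒱 ∧
      #↥(⋂ V ∈ 𝒱, closure V) ≤ 2 ^ (skL X (2 ^ (psi X * lam)) * psi X * lam) := by
  intro x
  have hl0 : lam ≠ 0 := (aleph0_pos.trans_le hlam).ne'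
  obtain ⟨hs, hS⟩ := skL_spec_aux X (2 ^ (psi X * lam)) (Cardinal.power_pos _ two_pos)
  obtain ⟨hp, hP⟩ := psi_spec_aux X
  set μ : Cardinal.{u} := 2 ^ (psi X * lam) with hμ
  set σ := skL X μ with hσ
  have hp0 : psi X ≠ 0 := (aleph0_pos.trans_le hp).ne'
  have hs0 : σ ≠ 0 := (aleph0_pos.trans_le hs).ne'
  obtain ⟨𝒰, hUo, hUc, hUx⟩ := hP x
  have key : ∀ U : 𝒰, ∃ 𝒲 : Set (Set X), (∀ W ∈ 𝒲, IsOpen W ∧ x ∉ closure W) ∧ #↥𝒲 ≤ σ ∧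
      #↥((U : Set X)ᶜ \ ⋃₀ 𝒲) < μ := by
    rintro ⟨U, hU⟩
    have hxU : x ∈ U := by
      have : x ∈ ⋂₀ 𝒰 := by rw [hUx]; rfl
      exact this U hU
    obtain ⟨𝒱, hsub, hcard, hrem⟩ := hS (insert U {W | IsOpen W ∧ x ∉ closure W})
      (by
        rintro W (rfl | hW)
        · exact hUo _ hU
        · exact hW.1)
      (by
        intro y _
        by_cases hy : y = x
        · exact ⟨U, Set.mem_insert _ _, hy ▸ hxU⟩
        · obtain ⟨A, B, hA, hB, hyA, hxB, hd⟩ := t2_separation hy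
          refine ⟨A, Or.inr ⟨hA, fun hx => ?_⟩, hyA⟩
          exact (hd.closure_left hB).le_bot ⟨hx, hxB⟩)
    refine ⟨{W ∈ 𝒱 | IsOpen W ∧ x ∉ closure W}, fun W h => h.2,
      (mk_le_mk_of_subset (Set.sep_subset _ _)).trans hcard,
      (mk_le_mk_of_subset ?_).trans_lt hrem⟩
    rintro z ⟨hzU, hz⟩
    refine ⟨trivial, ?_⟩
    rintro ⟨W, hW, hzW⟩
    rcases hsub hW with rfl | h
    · exact hzU hzW
    · exact hz ⟨W, ⟨hW, h⟩, hzW⟩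
  choose 𝒲 hW hWc hWr using key
  have hpσ : psi X * σ ≤ σ * psi X * lam := by
    rw [mul_comm (psi X)]
    exact le_mul_right hl0
  have hinf : ℵ₀ ≤ σ * psi X * lam := hlam.trans (le_mul_left (mul_ne_zero hs0 hp0))
  refine ⟨⋃ U : 𝒰, (fun W => (closure W)ᶜ) '' 𝒲 U, ?_, ?_, ?_, ?_⟩
  · intro V hV
    obtain ⟨U, W, hw, rfl⟩ := Set.mem_iUnion.1 hV
    exact isClosed_closure.isOpen_compl
  · refine le_trans ?_ hpσ
    refine (mk_iUnion_le_sum_mk).trans ((Cardinal.sum_le_sum _ (fun _ => σ) fun U =>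
      mk_image_le.trans (hWc U)).trans ?_)
    rw [Cardinal.sum_const']
    exact mul_le_mul' hUc le_rfl
  · intro V hV
    obtain ⟨U, W, hw, rfl⟩ := Set.mem_iUnion.1 hV
    exact (hW U W hw).2
  · have hsub : (⋂ V ∈ ⋃ U : 𝒰, (fun W => (closure W)ᶜ) '' 𝒲 U, closure V) ⊆
        {x} ∪ ⋃ U : 𝒰, ((U : Set X)ᶜ \ ⋃₀ 𝒲 U) := by
      intro z hz
      by_cases hzx : z = x
      · exact Or.inl hzx
      right
      have : z ∉ ⋂₀ 𝒰 := by rw [hUx]; exact hzx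
      simp only [Set.mem_sInter, not_forall] at this
      obtain ⟨U, hU, hzU⟩ := this
      refine Set.mem_iUnion.2 ⟨⟨U, hU⟩, hzU, ?_⟩
      rintro ⟨W, hw, hzW⟩
      have h1 : z ∈ closure ((closure W)ᶜ) :=
        Set.mem_iInter₂.1 hz _ (Set.mem_iUnion.2 ⟨⟨U, hU⟩, W, hw, rfl⟩)
      have h2 : closure ((closure W)ᶜ) ⊆ Wᶜ :=
        closure_minimal (Set.compl_subset_compl.2 subset_closure)
          (hW _ W hw).1.isClosed_compl
      exact h2 h1 hzW
    refine (mk_le_mk_of_subset hsub).trans ((mk_union_le _ _).trans ?_)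
    have hbig : ℵ₀ ≤ (2 : Cardinal.{u}) ^ (σ * psi X * lam) := hinf.trans (cantor _).le
    have hμ' : μ ≤ 2 ^ (σ * psi X * lam) := by
      refine power_le_power_left two_ne_zero ?_
      rw [mul_assoc]
      exact le_mul_left hs0
    refine add_le_of_le hbig ?_ ?_
    · rw [mk_singleton]
      exact one_le_aleph0.trans hbig
    · refine (mk_iUnion_le_sum_mk).trans ((Cardinal.sum_le_sum _ (fun _ => μ) fun U =>
        (hWr U).le).trans ?_)
      rw [Cardinal.sum_const']
      refine mul_le_of_le hbig ?_ hμ'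
      refine hUc.trans ((le_trans ?_ hpσ).trans (cantor _).le)
      exact le_mul_right hs0
end

section
/- For any Hausdorff space X: |X| ≤ 2^{saL_c(X, 2^{t(X)·ψ_c(X)}) · t(X) · ψ_c(X)}. -/
open Cardinal Set

universe u

theorem aux_closing {X K : Type u} [Infinite K] [Nonempty X] (G : (K → X) → Set X)
    (hG : ∀ a, #(G a) ≤ 2 ^ #K) :
    ∃ F : Set X, F.Nonempty ∧ #F ≤ 2 ^ #K ∧ ∀ a : K → X, (∀ k, a k ∈ F) → G a ⊆ F := by
  classical
  obtain ⟨x0⟩ := ‹Nonempty X›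
  have h1 : ∀ a, ∃ e : Set K → X, G a ⊆ range e := by
    intro a
    have : #(G a) ≤ #(Set K) := by rw [mk_set]; exact hG a
    obtain ⟨f⟩ := this
    refine ⟨Function.extend f Subtype.val (fun _ => x0), ?_⟩
    intro x hx
    exact ⟨f ⟨x, hx⟩, f.injective.extend_apply _ _ _⟩
  choose e he using h1
  have hK : ℵ₀ ≤ #K := aleph0_le_mk K
  let β : Option (Set K) → Type u := fun o => match o with
    | none => PEmpty
    | some _ => K
  let I : WType β → X := WType.elim X (fun p => match p with
    | ⟨none, _⟩ => x0
    | ⟨some s, g⟩ => e g s)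
  have hW : #(WType β) ≤ 2 ^ #K := by
    have h2 : ℵ₀ ≤ (2 : Cardinal.{u}) ^ #K := hK.trans (cantor _).le
    have h3 : #(Option (Set K)) ≤ 2 ^ #K := by
      rw [mk_option, mk_set]
      exact add_le_of_le h2 le_rfl (one_le_aleph0.trans h2)
    apply WType.cardinalMk_le_of_le
    calc Cardinal.sum (fun o => (2 ^ #K : Cardinal.{u}) ^ #(β o))
        ≤ Cardinal.sum (fun _ : Option (Set K) => (2 ^ #K : Cardinal.{u})) := by
          apply sum_le_sum
          rintro (_ | s)
          · simpa [β] using one_le_aleph0.trans h2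
          · show (2 ^ #K : Cardinal.{u}) ^ #K ≤ _
            rw [← power_mul, mul_eq_self hK]
      _ ≤ 2 ^ #K := by
          rw [sum_const']
          exact mul_le_of_le h2 h3 le_rfl
  refine ⟨range I, ⟨_, ⟨WType.mk none PEmpty.elim, rfl⟩⟩, mk_range_le.trans hW, ?_⟩
  intro a ha x hx
  choose w hw using ha
  obtain ⟨s, rfl⟩ := he a hx
  refine ⟨WType.mk (some s) w, ?_⟩
  show e (fun k => I (w k)) s = e a s
  congr 1
  exact funext hw

theorem aux_enum {X K : Type u} (x0 : X) (S : Set X) (h : #S ≤ #K) :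
    ∃ f : K → X, S ⊆ range f ∧ ∀ k, f k ∈ S ∨ f k = x0 := by
  classical
  obtain ⟨f⟩ := h
  refine ⟨Function.extend f Subtype.val (fun _ => x0), ?_, ?_⟩
  · intro x hx
    exact ⟨f ⟨x, hx⟩, f.injective.extend_apply _ _ _⟩
  · intro k
    by_cases hk : ∃ s, f s = k
    · obtain ⟨s, rfl⟩ := hk
      left
      rw [f.injective.extend_apply]
      exact s.2
    · right
      rw [Function.extend_apply' _ _ _ hk]

theorem aux_main {X K : Type u} [TopologicalSpace X] [Infinite K] (lam : Cardinal.{u})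
    (hlam : lam ≤ 2 ^ #K)
    (ht : ∀ (A : Set X) (x : X), x ∈ closure A → ∃ B ⊆ A, #↥B ≤ #K ∧ x ∈ closure B)
    (v : X → K → Set X) (hvo : ∀ x k, IsOpen (v x k)) (hvm : ∀ x k, x ∈ v x k)
    (hv : ∀ x y, (∀ k, y ∈ closure (v x k)) → y = x)
    (hL : ∀ A : Set X, IsClosed A → ∀ 𝒰 : Set (Set X), (∀ U ∈ 𝒰, IsOpen U) → A ⊆ ⋃₀ 𝒰 →
      ∃ 𝒱 ⊆ 𝒰, #↥𝒱 ≤ #K ∧ #↥(A \ ⋃ V ∈ 𝒱, closure V) < lam) :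
    #X ≤ 2 ^ #K := by
  classical
  rcases isEmpty_or_nonempty X with hX | hX
  · simp
  have hK : ℵ₀ ≤ #K := aleph0_le_mk K
  have h2 : ℵ₀ ≤ (2 : Cardinal.{u}) ^ #K := hK.trans (cantor _).le
  have hC : ∀ T : Set X, ∃ C ⊆ T, #C ≤ lam ∧ (lam ≤ #C ∨ C = T) := by
    intro T
    rcases le_total lam #T with h | h
    · obtain ⟨C, hC, hC'⟩ := le_mk_iff_exists_subset.1 h
      exact ⟨C, hC, hC'.le, Or.inl hC'.ge⟩
    · exact ⟨T, le_rfl, h, Or.inr rfl⟩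
  choose C hCT hCle hCor using hC
  let R : (K → X) → Set (K × K) → Set X := fun a P =>
    C (Set.univ \ ⋃ p ∈ P, closure (v (a p.1) p.2))
  let G : (K → X) → Set X := fun a => closure (range a) ∪ ⋃ P, R a P
  have hG : ∀ a, #(G a) ≤ 2 ^ #K := by
    intro a
    refine (mk_union_le _ _).trans (add_le_of_le h2 ?_ ?_)
    · let φ : closure (range a) → (K → Set K) := fun x k => {j | a j ∈ v x k}
      have hφ : Function.Injective φ := by
        intro x y hxy
        refine Subtype.ext (hv y x ?_)
        intro k
        have hx : (x : X) ∈ closure (v x k ∩ range a) :=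
          mem_closure_iff_nhds.2 fun t ht' => by
            obtain ⟨z, hz, hz'⟩ := mem_closure_iff_nhds.1 x.2 (t ∩ v x k)
              (Filter.inter_mem ht' ((hvo x k).mem_nhds (hvm x k)))
            exact ⟨z, hz.1, hz.2, hz'⟩
        refine closure_mono ?_ hx
        rintro _ ⟨hj, j, rfl⟩
        have hj' : j ∈ φ x k := hj
        rw [hxy] at hj'
        exact hj'
      calc #(closure (range a)) ≤ #(K → Set K) := mk_le_of_injective hφ
        _ = 2 ^ #K := by
          rw [← power_def, mk_set, ← power_mul, mul_eq_self hK]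
    · refine (mk_iUnion_le _).trans (mul_le_of_le h2 ?_ ?_)
      · rw [mk_set, ← mul_def, mul_eq_self hK]
      · exact ciSup_le' fun P => (hCle _).trans hlam
  obtain ⟨F, ⟨x0, hx0⟩, hF, hFG⟩ := aux_closing G hG
  have hFc : IsClosed F := by
    apply isClosed_of_closure_subset
    intro x hx
    obtain ⟨B, hB, hBK, hxB⟩ := ht F x hx
    obtain ⟨a, ha, ha'⟩ := aux_enum x0 B hBK
    refine hFG a (fun k => ?_) (Or.inl (closure_mono ha hxB))
    rcases ha' k with h | h
    · exact hB h
    · rwa [h]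
  suffices h : F = Set.univ by
    rw [h, mk_univ] at hF
    exact hF
  by_contra hne
  obtain ⟨p, hp⟩ := (ne_univ_iff_exists_notMem F).1 hne
  have hk : ∀ x : X, ∃ k, x ∈ F → p ∉ closure (v x k) := by
    intro x
    by_contra! h
    have hxF : x ∈ F := (h (Classical.arbitrary K)).1
    exact hp ((hv x p fun k => (h k).2) ▸ hxF)
  choose c hc using hk
  obtain ⟨𝒱, h𝒱, h𝒱K, h𝒱l⟩ := hL F hFc ((fun x => v x (c x)) '' F)
    (by rintro _ ⟨x, -, rfl⟩; exact hvo _ _)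
    (fun x hx => ⟨_, ⟨x, hx, rfl⟩, hvm _ _⟩)
  choose! g hgF hg using h𝒱
  obtain ⟨a, ha, ha'⟩ := aux_enum x0 (g '' 𝒱) (mk_image_le.trans h𝒱K)
  have haF : ∀ k, a k ∈ F := by
    intro k
    rcases ha' k with ⟨V, hV, h⟩ | h
    · exact h ▸ hgF hV
    · rwa [h]
  let P : Set (K × K) := {q | v (a q.1) q.2 ∈ 𝒱}
  have hPU : (⋃ q ∈ P, closure (v (a q.1) q.2)) = ⋃ V ∈ 𝒱, closure V := by
    ext y
    simp only [mem_iUnion, exists_prop]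
    constructor
    · rintro ⟨q, hq, hy⟩
      exact ⟨_, hq, hy⟩
    · rintro ⟨V, hV, hy⟩
      obtain ⟨k, hk⟩ := ha ⟨V, hV, rfl⟩
      have : v (a k) (c (a k)) = V := by rw [hk]; exact hg hV
      refine ⟨(k, c (a k)), ?_, ?_⟩
      · show v (a k) (c (a k)) ∈ 𝒱
        rwa [this]
      · show y ∈ closure (v (a k) (c (a k)))
        rwa [this]
  have hRF : R a P ⊆ F := fun x hx => hFG a haF (Or.inr (mem_iUnion.2 ⟨P, hx⟩))
  have hRT : R a P ⊆ Set.univ \ ⋃ V ∈ 𝒱, closure V := by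
    rw [← hPU]; exact hCT _
  have hpT : p ∈ Set.univ \ ⋃ q ∈ P, closure (v (a q.1) q.2) := by
    rw [hPU]
    refine ⟨mem_univ _, ?_⟩
    simp only [mem_iUnion, exists_prop, not_exists, not_and]
    intro V hV
    rw [← hg hV]
    exact hc _ (hgF hV)
  rcases hCor (Set.univ \ ⋃ q ∈ P, closure (v (a q.1) q.2)) with h | h
  · refine absurd (h.trans (mk_le_mk_of_subset ?_)) (not_le.2 h𝒱l)
    exact fun x hx => ⟨hRF hx, (hRT hx).2⟩
  · refine hp (hRF ?_)
    show p ∈ C _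
    rw [h]
    exact hpT

theorem aux_tight (X : Type u) [TopologicalSpace X] : ℵ₀ ≤ tight X ∧
    ∀ (A : Set X) (x : X), x ∈ closure A → ∃ B ⊆ A, #↥B ≤ tight X ∧ x ∈ closure B := by
  refine csInf_mem (s := {κ : Cardinal.{u} | ℵ₀ ≤ κ ∧
    ∀ (A : Set X) (x : X), x ∈ closure A → ∃ B ⊆ A, #↥B ≤ κ ∧ x ∈ closure B}) ?_
  exact ⟨max ℵ₀ #X, le_max_left _ _, fun A x hx =>
    ⟨A, le_rfl, (mk_set_le A).trans (le_max_right _ _), hx⟩⟩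

theorem aux_psic (X : Type u) [TopologicalSpace X] [T2Space X] : ℵ₀ ≤ psic X ∧
    ∀ x : X, ∃ 𝒱 : Set (Set X), (∀ V ∈ 𝒱, IsOpen V ∧ x ∈ V) ∧ #↥𝒱 ≤ psic X ∧
      (⋂ V ∈ 𝒱, closure V) = {x} := by
  refine csInf_mem (s := {κ : Cardinal.{u} | ℵ₀ ≤ κ ∧
    ∀ x : X, ∃ 𝒱 : Set (Set X), (∀ V ∈ 𝒱, IsOpen V ∧ x ∈ V) ∧ #↥𝒱 ≤ κ ∧
      (⋂ V ∈ 𝒱, closure V) = {x}}) ?_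
  refine ⟨max ℵ₀ #(Set X), le_max_left _ _, fun x =>
    ⟨{V | IsOpen V ∧ x ∈ V}, fun V hV => hV, (mk_set_le _).trans (le_max_right _ _), ?_⟩⟩
  ext y
  simp only [mem_iInter, mem_singleton_iff, mem_setOf_eq]
  constructor
  · intro h
    by_contra hne
    obtain ⟨U, V, hU, hV, hyU, hxV, hd⟩ := t2_separation hne
    obtain ⟨z, hz, hz'⟩ := mem_closure_iff.1 (h V ⟨hV, hxV⟩) U hU hyU
    exact Set.disjoint_left.1 hd hz hz'
  · rintro rfl V hV
    exact subset_closure hV.2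

theorem aux_saL (X : Type u) [TopologicalSpace X] (A : Set X) (lam : Cardinal.{u})
    (h : 0 < lam) : ℵ₀ ≤ saLrel X A lam ∧
    ∀ 𝒰 : Set (Set X), (∀ U ∈ 𝒰, IsOpen U) → A ⊆ ⋃₀ 𝒰 →
      ∃ 𝒱 ⊆ 𝒰, #↥𝒱 ≤ saLrel X A lam ∧ #↥(A \ ⋃ V ∈ 𝒱, closure V) < lam := by
  refine csInf_mem (s := {κ : Cardinal.{u} | ℵ₀ ≤ κ ∧
    ∀ 𝒰 : Set (Set X), (∀ U ∈ 𝒰, IsOpen U) → A ⊆ ⋃₀ 𝒰 →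
      ∃ 𝒱 ⊆ 𝒰, #↥𝒱 ≤ κ ∧ #↥(A \ ⋃ V ∈ 𝒱, closure V) < lam}) ?_
  refine ⟨max ℵ₀ #(Set X), le_max_left _ _, fun 𝒰 _ hA =>
    ⟨𝒰, le_rfl, (mk_set_le _).trans (le_max_right _ _), ?_⟩⟩
  have : A \ ⋃ V ∈ 𝒰, closure V = ∅ := by
    refine diff_eq_empty.2 fun x hx => ?_
    obtain ⟨U, hU, hxU⟩ := hA hx
    exact mem_biUnion hU (subset_closure hxU)
  rw [this]
  simpa using h

theorem aux_saLc (X : Type u) [TopologicalSpace X] (A : Set X) (hA : IsClosed A)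
    (lam : Cardinal.{u}) : saLrel X A lam ≤ saLc X lam := by
  refine le_csSup ?_ ⟨A, hA, rfl⟩
  refine (bddAbove_range (fun A : Set X => saLrel X A lam)).mono ?_
  rintro _ ⟨A, -, rfl⟩
  exact ⟨A, rfl⟩

/-- Corollary 4.6: |X| ≤ 2^{saL_c(X,2^{t(X)ψ_c(X)})·t(X)·ψ_c(X)}. -/
theorem card_le_two_pow_saLc {X : Type u} [TopologicalSpace X] [T2Space X] :
    #X ≤ 2 ^ (saLc X (2 ^ (tight X * psic X)) * tight X * psic X) := by
  obtain ⟨ht0, ht⟩ := aux_tight X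
  obtain ⟨hp0, hp⟩ := aux_psic X
  have hlam0 : (0 : Cardinal.{u}) < 2 ^ (tight X * psic X) :=
    (Cardinal.zero_le _).trans_lt (cantor _)
  have hs0 : ℵ₀ ≤ saLc X (2 ^ (tight X * psic X)) :=
    (aux_saL X ∅ _ hlam0).1.trans (aux_saLc X ∅ isClosed_empty _)
  generalize hlam : (2 : Cardinal.{u}) ^ (tight X * psic X) = lam at *
  have ht1 : tight X ≠ 0 := (aleph0_pos.trans_le ht0).ne'
  have hp1 : psic X ≠ 0 := (aleph0_pos.trans_le hp0).ne'
  have hs1 : saLc X lam ≠ 0 := (aleph0_pos.trans_le hs0).ne'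
  have hs : saLc X lam ≤ saLc X lam * tight X * psic X :=
    (le_mul_right ht1).trans (le_mul_right hp1)
  have htκ : tight X ≤ saLc X lam * tight X * psic X :=
    (le_mul_left hs1).trans (le_mul_right hp1)
  have hpκ : psic X ≤ saLc X lam * tight X * psic X :=
    le_mul_left (mul_ne_zero hs1 ht1)
  have htpκ : tight X * psic X ≤ saLc X lam * tight X * psic X := by
    rw [mul_assoc]; exact le_mul_left hs1
  generalize saLc X lam * tight X * psic X = κ at *
  obtain ⟨K, rfl⟩ : ∃ K : Type u, #K = κ := ⟨κ.out, mk_out κ⟩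
  have : Infinite K := infinite_iff.2 (hs0.trans hs)
  have hv : ∀ x : X, ∃ v : K → Set X, (∀ k, IsOpen (v k)) ∧ (∀ k, x ∈ v k) ∧
      ∀ y, (∀ k, y ∈ closure (v k)) → y = x := by
    intro x
    obtain ⟨𝒱, h1, h2, h3⟩ := hp x
    obtain ⟨f, hf, hf'⟩ := aux_enum (K := K) Set.univ 𝒱 (h2.trans hpκ)
    refine ⟨f, fun k => ?_, fun k => ?_, fun y hy => ?_⟩
    · rcases hf' k with h | h
      · exact (h1 _ h).1
      · rw [h]; exact isOpen_univ
    · rcases hf' k with h | h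
      · exact (h1 _ h).2
      · rw [h]; exact mem_univ _
    · have : y ∈ ⋂ V ∈ 𝒱, closure V := by
        simp only [mem_iInter]
        intro V hV
        obtain ⟨k, rfl⟩ := hf hV
        exact hy k
      rw [h3] at this
      exact this
  choose v hvo hvm hv using hv
  refine aux_main lam ?_ ?_ v hvo hvm hv ?_
  · rw [← hlam]
    exact power_le_power_left two_ne_zero htpκ
  · intro A x hx
    obtain ⟨B, hB, h, hx⟩ := ht A x hx
    exact ⟨B, hB, h.trans htκ, hx⟩
  · intro A hA 𝒰 h𝒰 hc
    obtain ⟨𝒱, h1, h2, h3⟩ := (aux_saL X A lam hlam0).2 𝒰 h𝒰 hc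
    exact ⟨𝒱, h1, h2.trans ((aux_saLc X A hA lam).trans hs), h3⟩
end
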